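/- Let C be an abelian category in which every monomorphism splits, equipped with an additive auto-equivalence Σ : C → C. Then C admits the structure of a triangulated category (satisfying all the axioms of a triangulation, including the octahedral axiom) with suspension functor Σ, in which the distinguished triangles are exactly the diagrams isomorphic to one of the form A⊕B → B⊕C → C⊕ΣA → ΣA⊕ΣB, where the three maps are given on components by (a,b) ↦ (b,0), (b,c) ↦ (c,0), and (c,a') ↦ (a',0). -/

import Mathlib

/-!
Formalization of statements from N. P. Strickland,
"Axiomatic stable homotopy --- a survey" (arXiv:math/0307143).
-/

open CategoryTheory CategoryTheory.Limits CategoryTheory.Pretriangulated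

universe w v u

namespace AxStable

variable {C : Type u} [Category.{v} C]

/-- The basic split triangle `A⊕B → B⊕D → D⊕ΣA → Σ(A⊕B)` with maps `(a,b) ↦ (b,0)`,
`(b,d) ↦ (d,0)` and `(d,a') ↦ (a',0)`. -/
noncomputable def splitTriangle (C : Type u) [Category.{v} C] [Abelian C] [HasShift C ℤ]
    (A B D : C) : Triangle C :=
  Triangle.mk
    (biprod.snd ≫ biprod.inl : A ⊞ B ⟶ B ⊞ D)
    (biprod.snd ≫ biprod.inl : B ⊞ D ⟶ D ⊞ ((A)⟦(1:ℤ)⟧))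
    (biprod.snd ≫ (shiftFunctor C (1:ℤ)).map biprod.inl)

/-- A sequence of objects `X n` for `n : ℤ`, with isomorphisms between the image of each term
under the functor `S` and the next term. -/
structure Spectrum (S : C ⥤ C) where
  /-- The terms of the sequence. -/
  X : ℤ → C
  /-- The structure isomorphisms. -/
  e : ∀ m n : ℤ, m + 1 = n → (S.obj (X m) ≅ X n)

namespace Spectrum

variable {S : C ⥤ C}

/-- A morphism of spectra is a family of morphisms commuting with the structure isomorphisms. -/
@[ext]
structure Hom (K L : Spectrum S) where
  /-- The components of a morphism. -/
  f : ∀ n : ℤ, K.X n ⟶ L.X n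
  comm : ∀ (m n : ℤ) (h : m + 1 = n), S.map (f m) ≫ (L.e m n h).hom = (K.e m n h).hom ≫ f n

instance : Category (Spectrum S) where
  Hom := Hom
  id K := { f := fun _ ↦ 𝟙 _, comm := by simp }
  comp φ ψ :=
    { f := fun n ↦ φ.f n ≫ ψ.f n
      comm := fun m n h ↦ by simp [ψ.comm m n h, reassoc_of% φ.comm m n h] }

@[simp]
lemma id_f (K : Spectrum S) (n : ℤ) : (𝟙 K : K ⟶ K).f n = 𝟙 (K.X n) := rfl

@[simp]
lemma comp_f {K L M : Spectrum S} (φ : K ⟶ L) (ψ : L ⟶ M) (n : ℤ) :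
    (φ ≫ ψ).f n = φ.f n ≫ ψ.f n := rfl

@[ext]
lemma hom_ext {K L : Spectrum S} {φ ψ : K ⟶ L} (h : ∀ n, φ.f n = ψ.f n) : φ = ψ :=
  Hom.ext (funext h)

/-- The isomorphism of spectra attached to a compatible family of isomorphisms. -/
def isoMk {K L : Spectrum S} (φ : ∀ n, K.X n ≅ L.X n)
    (comm : ∀ (m n : ℤ) (h : m + 1 = n),
      S.map (φ m).hom ≫ (L.e m n h).hom = (K.e m n h).hom ≫ (φ n).hom) : K ≅ L where
  hom := { f := fun n ↦ (φ n).hom, comm := comm }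
  inv :=
    { f := fun n ↦ (φ n).inv
      comm := fun m n h ↦ by
        rw [← cancel_mono (φ n).hom, ← cancel_epi (S.map (φ m).hom)]
        simp [comm, ← Functor.map_comp_assoc] }
  hom_inv_id := by ext; simp
  inv_hom_id := by ext; simp

@[simp]
lemma eqToHom_f {K L : Spectrum S} (h : K = L) (n : ℤ) :
    (eqToHom h).f n = eqToHom (by rw [h]) := by
  subst h
  rfl

lemma f_comp_eqToHom {K L : Spectrum S} (φ : K ⟶ L) {m n : ℤ} (h : m = n) :
    φ.f m ≫ eqToHom (by rw [h]) = eqToHom (by rw [h]) ≫ φ.f n := by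
  subst h
  simp

lemma e_hom_comp_eqToHom (K : Spectrum S) {m n m' n' : ℤ} (h : m + 1 = n) (h' : m' + 1 = n')
    (hm : m = m') :
    (K.e m n h).hom ≫ eqToHom (by congr 1; lia) =
      S.map (eqToHom (by rw [hm])) ≫ (K.e m' n' h').hom := by
  subst hm h h'
  simp

variable (S) in
/-- The functor shifting the terms of a spectrum. -/
@[simps]
def translate (k : ℤ) : Spectrum S ⥤ Spectrum S where
  obj K :=
    { X := fun n ↦ K.X (n + k)
      e := fun m n h ↦ K.e (m + k) (n + k) (by lia) }
  map φ :=
    { f := fun n ↦ φ.f (n + k)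
      comm := fun m n h ↦ φ.comm _ _ _ }

variable (S) in
/-- Translation by zero is the identity. -/
def translateZero : translate S 0 ≅ 𝟭 (Spectrum S) :=
  NatIso.ofComponents
    (fun K ↦ isoMk (fun n ↦ eqToIso (congr_arg K.X (add_zero n))) fun m n h ↦
      (e_hom_comp_eqToHom K (by lia) (by lia) (by lia)).symm)
    fun φ ↦ by
      ext n
      exact f_comp_eqToHom φ (add_zero n)

variable (S) in
/-- Translations compose additively. -/
def translateAdd (a b : ℤ) : translate S (a + b) ≅ translate S a ⋙ translate S b :=
  NatIso.ofComponents
    (fun K ↦ isoMk (fun n ↦ eqToIso (congr_arg K.X (by lia : n + (a + b) = n + b + a)))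
      fun m n h ↦ (e_hom_comp_eqToHom K (by lia) (by lia) (by lia)).symm)
    fun φ ↦ by
      ext n
      exact f_comp_eqToHom φ (by lia)

@[simp]
lemma translateZero_inv_app_f (K : Spectrum S) (n : ℤ) :
    ((translateZero S).inv.app K).f n = eqToHom (congr_arg K.X (add_zero n).symm) :=
  rfl

@[simp]
lemma translateAdd_hom_app_f (a b : ℤ) (K : Spectrum S) (n : ℤ) :
    ((translateAdd S a b).hom.app K).f n =
      eqToHom (congr_arg K.X (by lia : n + (a + b) = n + b + a)) :=
  rfl

instance : HasShift (Spectrum S) ℤ :=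
  hasShiftMk _ _
    { F := translate S
      zero := translateZero S
      add := translateAdd S
      assoc_hom_app := fun _ _ _ _ ↦ by
        ext
        simp only [comp_f, translateAdd_hom_app_f, translate_map_f, eqToHom_f]
        exact (eqToHom_trans _ _).trans
          ((congr_arg _ (eqToHom_trans _ _)).trans (eqToHom_trans _ _)).symm
      zero_add_hom_app := fun _ _ ↦ by
        ext
        simp only [comp_f, translateAdd_hom_app_f, translateZero_inv_app_f, translate_map_f,
          eqToHom_f]
        exact (eqToHom_trans _ _).symm
      add_zero_hom_app := fun _ _ ↦ by
        ext
        simp only [comp_f, translateAdd_hom_app_f, translateZero_inv_app_f, eqToHom_f]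
        exact (eqToHom_trans _ _).symm }

variable (S) in
/-- The functor sending a spectrum to its term in degree zero. -/
@[simps]
def evalZero : Spectrum S ⥤ C where
  obj K := K.X 0
  map φ := φ.f 0

lemma f_eq_iff [S.Faithful] {K L : Spectrum S} (φ ψ : K ⟶ L) {m n : ℤ} (h : m + 1 = n) :
    φ.f n = ψ.f n ↔ φ.f m = ψ.f m := by
  rw [← cancel_epi (K.e m n h).hom, ← φ.comm, ← ψ.comm, cancel_mono, S.map_injective.eq_iff]

instance [S.Faithful] : (evalZero S).Faithful where
  map_injective {K L φ ψ} h := by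
    ext n
    induction n using Int.induction_on with
    | zero => exact h
    | succ n ih => exact (f_eq_iff φ ψ rfl).2 ih
    | pred n ih => exact (f_eq_iff φ ψ (by lia)).1 ih

/-- The components in nonnegative degrees of the extension of a morphism between the terms of
degree zero. -/
def extendNat {K L : Spectrum S} (a : K.X 0 ⟶ L.X 0) : ∀ n : ℕ, K.X n ⟶ L.X n
  | 0 => a
  | n + 1 => (K.e n _ rfl).inv ≫ S.map (extendNat a n) ≫ (L.e n _ rfl).hom

/-- The components in nonpositive degrees of the extension of a morphism between the terms of
degree zero. -/
noncomputable def extendNeg [S.Full] {K L : Spectrum S} (a : K.X 0 ⟶ L.X 0) :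
    ∀ n : ℕ, K.X (-n) ⟶ L.X (-n)
  | 0 => a
  | n + 1 => S.preimage ((K.e _ (-(n : ℤ)) (by lia)).hom ≫ extendNeg a n ≫
      (L.e _ (-(n : ℤ)) (by lia)).inv)

lemma map_extendNeg [S.Full] {K L : Spectrum S} (a : K.X 0 ⟶ L.X 0) (n : ℕ) :
    S.map (extendNeg a (n + 1)) ≫ (L.e (-(n + 1 : ℕ)) (-n) (by lia)).hom =
      (K.e (-(n + 1 : ℕ)) (-n) (by lia)).hom ≫ extendNeg a n := by
  simp [extendNeg]

instance [S.Full] : (evalZero S).Full where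
  map_surjective {K L} a :=
    ⟨{ f := fun
          | .ofNat n => extendNat a n
          | .negSucc n => extendNeg a (n + 1)
       comm := fun m n h ↦ by
          subst h
          match m with
          | .ofNat m =>
            change S.map (extendNat a m) ≫ _ = (K.e m (m + 1) rfl).hom ≫
              (K.e m _ rfl).inv ≫ S.map (extendNat a m) ≫ (L.e m _ rfl).hom
            rw [Iso.hom_inv_id_assoc]
            rfl
          | .negSucc 0 => exact map_extendNeg a 0
          | .negSucc (m + 1) => exact map_extendNeg a (m + 1) }, rfl⟩

instance [S.IsEquivalence] : (evalZero S).EssSurj where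
  mem_essImage A := by
    let X : ℤ → C
      | .ofNat n => S.obj^[n] A
      | .negSucc n => S.inv.obj^[n + 1] A
    refine ⟨{ X := X, e := fun m n h ↦ ?_ }, ⟨Iso.refl _⟩⟩
    subst h
    match m with
    | .ofNat m => exact eqToIso (Function.iterate_succ_apply' S.obj m A).symm
    | .negSucc 0 => exact S.asEquivalence.counitIso.app A
    | .negSucc (m + 1) =>
      exact S.mapIso (eqToIso (Function.iterate_succ_apply' S.inv.obj (m + 1) A)) ≪≫
        S.asEquivalence.counitIso.app _

instance [S.IsEquivalence] : (evalZero S).IsEquivalence where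

end Spectrum

section Shift

variable (S : C ⥤ C) [S.IsEquivalence]

open Spectrum in
/-- The shift by integers whose shift functor in degree one is a given autoequivalence. -/
@[reducible]
noncomputable def shiftOfEquivalence : HasShift C ℤ :=
  HasShift.induced (evalZero S) ℤ
    (fun a ↦ (evalZero S).inv ⋙ shiftFunctor (Spectrum S) a ⋙ evalZero S)
    (fun _ ↦ (Functor.associator _ _ _).symm ≪≫
      Functor.isoWhiskerRight (evalZero S).asEquivalence.unitIso.symm _ ≪≫ Functor.leftUnitor _)

open Spectrum in
/-- The shift functor in degree one of `shiftOfEquivalence S` is `S`. -/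
noncomputable def shiftOfEquivalenceIso :
    letI := shiftOfEquivalence S
    shiftFunctor C (1 : ℤ) ≅ S :=
  let i : shiftFunctor (Spectrum S) (1 : ℤ) ⋙ evalZero S ≅ evalZero S ⋙ S :=
    NatIso.ofComponents (fun K ↦ (K.e 0 (0 + 1) rfl).symm) fun {K L} φ ↦ by
      change φ.f (0 + 1) ≫ (L.e 0 (0 + 1) rfl).inv = (K.e 0 (0 + 1) rfl).inv ≫ S.map (φ.f 0)
      rw [Iso.comp_inv_eq, Category.assoc, φ.comm, Iso.inv_hom_id_assoc]
  Functor.isoWhiskerLeft (evalZero S).inv i ≪≫ (Functor.associator _ _ _).symm ≪≫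
    Functor.isoWhiskerRight (evalZero S).asEquivalence.counitIso S ≪≫ S.leftUnitor

lemma shiftFunctor_additive [Preadditive C] [HasBinaryBiproducts C] [HasShift C ℤ] (n : ℤ) :
    (shiftFunctor C n).Additive :=
  have := preservesBinaryBiproducts_of_preservesBinaryProducts (shiftFunctor C n)
  Functor.additive_of_preservesBinaryBiproducts _

end Shift

lemma injective_of_mono_split
    (hsplit : ∀ (X Y : C) (f : X ⟶ Y), Mono f → ∃ r : Y ⟶ X, f ≫ r = 𝟙 X) (J : C) :
    Injective J where
  factors a m _ := by
    obtain ⟨r, hr⟩ := hsplit _ _ m inferInstance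
    exact ⟨r ≫ a, by simp [reassoc_of% hr]⟩

/-- A pair of composable morphisms is split exact if its composite vanishes and the identity of
the middle object is the sum of an endomorphism factoring through the first morphism and one
factoring through the second morphism. -/
def SplitExact [Preadditive C] {X Y Z : C}
    (f : X ⟶ Y) (g : Y ⟶ Z) : Prop :=
  f ≫ g = 0 ∧ ∃ (s : Y ⟶ X) (t : Z ⟶ Y), s ≫ f + g ≫ t = 𝟙 Y

namespace SplitExact

section Preadditive

variable [Preadditive C] {X Y Z : C} {f : X ⟶ Y} {g : Y ⟶ Z}

lemma exists_lift (h : SplitExact f g) {W : C} (a : W ⟶ Y) (ha : a ≫ g = 0) :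
    ∃ b : W ⟶ X, b ≫ f = a := by
  obtain ⟨-, s, t, hst⟩ := h
  refine ⟨a ≫ s, ?_⟩
  have := a ≫= hst
  simpa [reassoc_of% ha] using this

lemma exists_desc (h : SplitExact f g) {W : C} (a : Y ⟶ W) (ha : f ≫ a = 0) :
    ∃ b : Z ⟶ W, g ≫ b = a := by
  obtain ⟨-, s, t, hst⟩ := h
  refine ⟨t ≫ a, ?_⟩
  have := hst =≫ a
  simpa [ha] using this

lemma map {D : Type*} [Category* D] [Preadditive D] (h : SplitExact f g)
    (F : C ⥤ D) [F.Additive] : SplitExact (F.map f) (F.map g) := by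
  obtain ⟨hz, s, t, hst⟩ := h
  refine ⟨by rw [← F.map_comp, hz, F.map_zero], F.map s, F.map t, ?_⟩
  rw [← F.map_comp, ← F.map_comp, ← F.map_add, hst, F.map_id]

lemma map_iff {D : Type*} [Category* D] [Preadditive D]
    (F : C ⥤ D) [F.Additive] [F.Full] [F.Faithful] :
    SplitExact (F.map f) (F.map g) ↔ SplitExact f g := by
  refine ⟨fun ⟨hz, s, t, hst⟩ ↦ ⟨F.map_injective ?_, F.preimage s, F.preimage t,
    F.map_injective ?_⟩, fun h ↦ h.map F⟩
  · rw [F.map_comp, hz, F.map_zero]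
  · simpa using hst

lemma neg_right_iff : SplitExact f (-g) ↔ SplitExact f g := by
  suffices ∀ {g : Y ⟶ Z}, SplitExact f g → SplitExact f (-g) from
    ⟨fun h ↦ by simpa using this h, this⟩
  rintro g ⟨hz, s, t, hst⟩
  exact ⟨by simpa using hz, s, -t, by simpa using hst⟩

lemma neg_left_iff : SplitExact (-f) g ↔ SplitExact f g := by
  suffices ∀ {f : X ⟶ Y}, SplitExact f g → SplitExact (-f) g from
    ⟨fun h ↦ by simpa using this h, this⟩
  rintro f ⟨hz, s, t, hst⟩
  exact ⟨by simpa using hz, -s, t, by simpa using hst⟩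

lemma of_iso (h : SplitExact f g) {X' Y' Z' : C} {f' : X' ⟶ Y'} {g' : Y' ⟶ Z'}
    (e₁ : X ≅ X') (e₂ : Y ≅ Y') (e₃ : Z ≅ Z')
    (hf : f ≫ e₂.hom = e₁.hom ≫ f') (hg : g ≫ e₃.hom = e₂.hom ≫ g') : SplitExact f' g' := by
  obtain ⟨hz, s, t, hst⟩ := h
  obtain rfl : f' = e₁.inv ≫ f ≫ e₂.hom := by simp [hf]
  obtain rfl : g' = e₂.inv ≫ g ≫ e₃.hom := by simp [hg]
  refine ⟨by simp [reassoc_of% hz], e₂.inv ≫ s ≫ e₁.hom, e₃.inv ≫ t ≫ e₂.hom, ?_⟩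
  have := e₂.inv ≫= hst =≫ e₂.hom
  simpa using this

lemma precomp (h : SplitExact f g) {W : C} {e : W ⟶ X} {σ : X ⟶ W} (he : σ ≫ e = 𝟙 X) :
    SplitExact (e ≫ f) g := by
  obtain ⟨hz, s, t, hst⟩ := h
  exact ⟨by simp [hz], s ≫ σ, t, by simp [reassoc_of% he, hst]⟩

lemma postcomp (h : SplitExact f g) {W : C} {m : Z ⟶ W} {ρ : W ⟶ Z} (hm : m ≫ ρ = 𝟙 Z) :
    SplitExact f (g ≫ m) := by
  obtain ⟨hz, s, t, hst⟩ := h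
  exact ⟨by simp [reassoc_of% hz], s, ρ ≫ t, by simp [reassoc_of% hm, hst]⟩

lemma biprod_map [HasBinaryBiproducts C] (h : SplitExact f g) {X' Y' Z' : C} {f' : X' ⟶ Y'}
    {g' : Y' ⟶ Z'} (h' : SplitExact f' g') :
    SplitExact (biprod.map f f') (biprod.map g g') := by
  obtain ⟨hz, s, t, hst⟩ := h
  obtain ⟨hz', s', t', hst'⟩ := h'
  refine ⟨by ext <;> simp [hz, hz'], biprod.map s s', biprod.map t t', ?_⟩
  ext <;> simp [hst, hst']

lemma biprod_map_snd [HasBinaryBiproducts C] (h : SplitExact f g) {X' Y' : C}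
    {f' : X' ⟶ Y'} {σ : Y' ⟶ X'} (hσ : σ ≫ f' = 𝟙 Y') :
    SplitExact (biprod.map f' f) (biprod.snd ≫ g) := by
  obtain ⟨hz, s, t, hst⟩ := h
  refine ⟨by ext <;> simp [hz], biprod.map σ s, t ≫ biprod.inr, ?_⟩
  ext <;> simp [hσ, hst]

lemma inl_biprod_map [HasBinaryBiproducts C] (h : SplitExact f g) {Y' Z' : C}
    {g' : Y' ⟶ Z'} {ρ : Z' ⟶ Y'} (hρ : g' ≫ ρ = 𝟙 Y') :
    SplitExact (f ≫ biprod.inl) (biprod.map g g') := by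
  obtain ⟨hz, s, t, hst⟩ := h
  refine ⟨by ext <;> simp [hz], biprod.fst ≫ s, biprod.map t ρ, ?_⟩
  ext <;> simp [hρ, hst]

end Preadditive

section Abelian

variable [Abelian C]

lemma of_exact (hsplit : ∀ (X Y : C) (f : X ⟶ Y), Mono f → ∃ r : Y ⟶ X, f ≫ r = 𝟙 X)
    {X Y Z : C} {f : X ⟶ Y} {g : Y ⟶ Z} (w : f ≫ g = 0) (h : (ShortComplex.mk f g w).Exact) :
    SplitExact f g := by
  have := injective_of_mono_split hsplit
  have proj (P : C) : Projective P := ⟨fun {A B} a p _ ↦ by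
    have hp : (ShortComplex.mk (kernel.ι p) p (by simp)).ShortExact :=
      { exact := ShortComplex.exact_kernel p }
    have hs := hp.splittingOfInjective.s_g
    exact ⟨a ≫ hp.splittingOfInjective.s, by simpa using a ≫= hs⟩⟩
  obtain ⟨r, hr⟩ := hsplit _ _ (kernel.ι g) inferInstance
  have hf : f = kernel.lift g f w ≫ kernel.ι g := by simp
  have h₁ : (r ≫ kernel.ι g) ≫ g = 0 := by simp
  have h₂ : f ≫ (𝟙 Y - r ≫ kernel.ι g) = 0 := by
    rw [hf]
    simp only [Preadditive.comp_sub, Category.comp_id, Category.assoc, reassoc_of% hr, sub_self]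
  refine ⟨w, h.liftFromProjective _ h₁, h.descToInjective _ h₂, ?_⟩
  have e₁ := h.liftFromProjective_comp _ h₁
  have e₂ := h.comp_descToInjective _ h₂
  dsimp at e₁ e₂
  rw [e₁, e₂]
  abel

end Abelian

end SplitExact

section

open scoped ZeroObject

lemma exists_section_of_mono_split [Abelian C]
    (hsplit : ∀ (X Y : C) (f : X ⟶ Y), Mono f → ∃ r : Y ⟶ X, f ≫ r = 𝟙 X)
    {X Y : C} (p : X ⟶ Y) [Epi p] : ∃ σ : Y ⟶ X, σ ≫ p = 𝟙 Y := by
  have : SplitExact p (0 : Y ⟶ 0) :=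
    .of_exact hsplit (by simp) ((ShortComplex.exact_iff_epi _ rfl).2 inferInstance)
  exact this.exists_lift (𝟙 Y) (by simp)

end

section Triangles

open scoped ZeroObject

variable [Abelian C] [HasShift C ℤ]

/-- A triangle is split exact if it is split exact at each of its three vertices. -/
def IsSplitExactTriangle (T : Triangle C) : Prop :=
  SplitExact T.mor₁ T.mor₂ ∧ SplitExact T.mor₂ T.mor₃ ∧ SplitExact T.mor₃ (T.mor₁⟦(1 : ℤ)⟧')

lemma IsSplitExactTriangle.of_iso {T T' : Triangle C} (h : IsSplitExactTriangle T) (e : T ≅ T') :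
    IsSplitExactTriangle T' := by
  let e₁ := Triangle.π₁.mapIso e
  let e₂ := Triangle.π₂.mapIso e
  let e₃ := Triangle.π₃.mapIso e
  refine ⟨h.1.of_iso e₁ e₂ e₃ e.hom.comm₁ e.hom.comm₂,
    h.2.1.of_iso e₂ e₃ ((shiftFunctor C (1 : ℤ)).mapIso e₁) e.hom.comm₂ e.hom.comm₃,
    h.2.2.of_iso e₃ ((shiftFunctor C (1 : ℤ)).mapIso e₁) ((shiftFunctor C (1 : ℤ)).mapIso e₂)
      e.hom.comm₃ ?_⟩
  have := congr_arg (shiftFunctor C (1 : ℤ)).map e.hom.comm₁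
  rw [Functor.map_comp, Functor.map_comp] at this
  exact this

lemma IsSplitExactTriangle.exists_hom₃ {T₁ T₂ : Triangle C} (h₁ : IsSplitExactTriangle T₁)
    (h₂ : IsSplitExactTriangle T₂) (a : T₁.obj₁ ⟶ T₂.obj₁) (b : T₁.obj₂ ⟶ T₂.obj₂)
    (w : T₁.mor₁ ≫ b = a ≫ T₂.mor₁) :
    ∃ c : T₁.obj₃ ⟶ T₂.obj₃, T₁.mor₂ ≫ c = b ≫ T₂.mor₂ ∧
      T₁.mor₃ ≫ a⟦(1 : ℤ)⟧' = c ≫ T₂.mor₃ := by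
  have w' : T₁.mor₁⟦(1 : ℤ)⟧' ≫ b⟦1⟧' = a⟦1⟧' ≫ T₂.mor₁⟦1⟧' := by
    rw [← Functor.map_comp, w, Functor.map_comp]
  have hfg := h₂.1.1
  have hhf := h₁.2.2.1
  have hhf' := h₂.2.2.1
  obtain ⟨c₀, hc₀⟩ := h₁.1.exists_desc (b ≫ T₂.mor₂) (by rw [reassoc_of% w, hfg, comp_zero])
  obtain ⟨c₁, hc₁⟩ := h₂.2.2.exists_lift (T₁.mor₃ ≫ a⟦(1 : ℤ)⟧' - c₀ ≫ T₂.mor₃) (by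
    rw [Preadditive.sub_comp, Category.assoc, ← w', reassoc_of% hhf, Category.assoc, hhf',
      zero_comp, comp_zero, sub_zero])
  obtain ⟨hgh, s, t, hst⟩ := h₁.2.1
  refine ⟨c₀ + T₁.mor₃ ≫ t ≫ c₁, by simp [hc₀, reassoc_of% hgh], ?_⟩
  have h₀ : T₁.mor₂ ≫ (T₁.mor₃ ≫ a⟦(1 : ℤ)⟧' - c₀ ≫ T₂.mor₃) = 0 := by
    rw [Preadditive.comp_sub, reassoc_of% hgh, reassoc_of% hc₀, h₂.2.1.1, zero_comp, comp_zero,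
      sub_zero]
  have := hst =≫ (T₁.mor₃ ≫ a⟦(1 : ℤ)⟧' - c₀ ≫ T₂.mor₃)
  rw [Preadditive.add_comp, Category.assoc, h₀, comp_zero, zero_add, Category.id_comp] at this
  rw [Preadditive.add_comp, Category.assoc, Category.assoc, hc₁, ← Category.assoc, this]
  abel

lemma isSplitExactTriangle_contractible (X : C) :
    IsSplitExactTriangle (contractibleTriangle X) := by
  have h₁ : SplitExact (𝟙 X) (0 : X ⟶ 0) := ⟨by simp, 𝟙 X, 0, by simp⟩
  have h₂ : SplitExact (0 : X ⟶ 0) (0 : 0 ⟶ X⟦(1 : ℤ)⟧) :=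
    ⟨by simp, 0, 0, (isZero_zero C).eq_of_src _ _⟩
  have h₃ : SplitExact (0 : 0 ⟶ X⟦(1 : ℤ)⟧) ((𝟙 X)⟦(1 : ℤ)⟧') :=
    ⟨by simp, 0, 𝟙 _, by simp⟩
  exact ⟨h₁, h₂, h₃⟩

variable [∀ n : ℤ, (shiftFunctor C n).Additive]

lemma isSplitExactTriangle_rotate_iff (T : Triangle C) :
    IsSplitExactTriangle T ↔ IsSplitExactTriangle T.rotate := by
  have h₁ : SplitExact T.mor₃ (-(T.mor₁⟦(1 : ℤ)⟧')) ↔ SplitExact T.mor₃ (T.mor₁⟦(1 : ℤ)⟧') :=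
    SplitExact.neg_right_iff
  have h₂ : SplitExact (-(T.mor₁⟦(1 : ℤ)⟧')) (T.mor₂⟦(1 : ℤ)⟧') ↔ SplitExact T.mor₁ T.mor₂ :=
    SplitExact.neg_left_iff.trans (SplitExact.map_iff _)
  have : IsSplitExactTriangle T.rotate ↔ SplitExact T.mor₂ T.mor₃ ∧
      SplitExact T.mor₃ (-(T.mor₁⟦(1 : ℤ)⟧')) ∧
      SplitExact (-(T.mor₁⟦(1 : ℤ)⟧')) (T.mor₂⟦(1 : ℤ)⟧') := Iff.rfl
  rw [this, h₁, h₂, IsSplitExactTriangle]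
  tauto

/-- The standard split exact triangle on a morphism, with third vertex
`coker f ⊞ (ker f)⟦1⟧`. -/
noncomputable def coneTriangle {X Y : C} (f : X ⟶ Y) : Triangle C :=
  Triangle.mk f (cokernel.π f ≫ biprod.inl : Y ⟶ cokernel f ⊞ (kernel f)⟦(1 : ℤ)⟧)
    (biprod.snd ≫ (kernel.ι f)⟦(1 : ℤ)⟧')

lemma isSplitExactTriangle_cone
    (hsplit : ∀ (X Y : C) (f : X ⟶ Y), Mono f → ∃ r : Y ⟶ X, f ≫ r = 𝟙 X)
    {X Y : C} (f : X ⟶ Y) : IsSplitExactTriangle (coneTriangle f) := by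
  have hι : SplitExact (kernel.ι f) f := .of_exact hsplit (by simp) (ShortComplex.exact_kernel f)
  have hπ : SplitExact f (cokernel.π f) :=
    .of_exact hsplit (by simp) (ShortComplex.exact_cokernel f)
  obtain ⟨r, hr⟩ := hsplit _ _ (kernel.ι f) inferInstance
  obtain ⟨σ, hσ⟩ := exists_section_of_mono_split hsplit (cokernel.π f)
  have hr' : (kernel.ι f)⟦(1 : ℤ)⟧' ≫ r⟦(1 : ℤ)⟧' = 𝟙 _ := by
    rw [← Functor.map_comp, hr, CategoryTheory.Functor.map_id]
  have h₂ : SplitExact (cokernel.π f ≫ biprod.inl : Y ⟶ cokernel f ⊞ (kernel f)⟦(1 : ℤ)⟧)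
      (biprod.snd ≫ (kernel.ι f)⟦(1 : ℤ)⟧') := by
    refine ⟨by simp, biprod.fst ≫ σ, r⟦(1 : ℤ)⟧' ≫ biprod.inr, ?_⟩
    simp [reassoc_of% hσ, reassoc_of% hr', biprod.total]
  exact ⟨hπ.postcomp biprod.inl_fst, h₂,
    (hι.map (shiftFunctor C (1 : ℤ))).precomp biprod.inr_snd⟩

/-- The pretriangulated structure whose distinguished triangles are the split exact ones. -/
@[reducible]
noncomputable def splitPretriangulated
    (hsplit : ∀ (X Y : C) (f : X ⟶ Y), Mono f → ∃ r : Y ⟶ X, f ≫ r = 𝟙 X) :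
    Pretriangulated C where
  distinguishedTriangles := {T | IsSplitExactTriangle T}
  isomorphic_distinguished _ h _ e := IsSplitExactTriangle.of_iso h e.symm
  contractible_distinguished := isSplitExactTriangle_contractible
  distinguished_cocone_triangle f := ⟨_, _, _, isSplitExactTriangle_cone hsplit f⟩
  rotate_distinguished_triangle := isSplitExactTriangle_rotate_iff
  complete_distinguished_triangle_morphism _ _ h₁ h₂ := h₁.exists_hom₃ h₂

open kernelCokernelCompSequence in
lemma isSplitExactTriangle_octahedron
    (hsplit : ∀ (X Y : C) (f : X ⟶ Y), Mono f → ∃ r : Y ⟶ X, f ≫ r = 𝟙 X)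
    {X Y Z : C} (f : X ⟶ Y) (g : Y ⟶ Z) :
    IsSplitExactTriangle (Triangle.mk
      (biprod.map (cokernel.map f (f ≫ g) (𝟙 _) g (by simp))
        ((kernel.map f (f ≫ g) (𝟙 _) g (by simp))⟦(1 : ℤ)⟧'))
      (biprod.map (cokernel.map (f ≫ g) g f (𝟙 _) (by simp))
        ((kernel.map (f ≫ g) g f (𝟙 _) (by simp))⟦(1 : ℤ)⟧'))
      ((biprod.snd ≫ (kernel.ι g)⟦(1 : ℤ)⟧') ≫
        (cokernel.π f ≫ biprod.inl : Y ⟶ cokernel f ⊞ (kernel f)⟦(1 : ℤ)⟧)⟦(1 : ℤ)⟧')) := by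
  have ex := kernelCokernelCompSequence_exact f g
  have e₀ := SplitExact.of_exact hsplit _ (ex.exact 0)
  have e₁ := SplitExact.of_exact hsplit _ (ex.exact 1)
  have e₂ := SplitExact.of_exact hsplit _ (ex.exact 2)
  have e₃ := SplitExact.of_exact hsplit _ (ex.exact 3)
  change SplitExact (kernel.map f (f ≫ g) (𝟙 _) g (by simp))
    (kernel.map (f ≫ g) g f (𝟙 _) (by simp)) at e₀
  change SplitExact (kernel.map (f ≫ g) g f (𝟙 _) (by simp)) (δ f g) at e₁
  change SplitExact (δ f g) (cokernel.map f (f ≫ g) (𝟙 _) g (by simp)) at e₂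
  change SplitExact (cokernel.map f (f ≫ g) (𝟙 _) g (by simp))
    (cokernel.map (f ≫ g) g f (𝟙 _) (by simp)) at e₃
  rw [δ_fac] at e₁ e₂
  rw [SplitExact.neg_right_iff] at e₁
  rw [SplitExact.neg_left_iff] at e₂
  obtain ⟨ρ, hρ⟩ := hsplit _ _ (kernel.map f (f ≫ g) (𝟙 _) g (by simp)) inferInstance
  obtain ⟨σ, hσ⟩ := exists_section_of_mono_split hsplit (cokernel.map (f ≫ g) g f (𝟙 _) (by simp))
  let i : cokernel f ⟶ cokernel f ⊞ (kernel f)⟦(1 : ℤ)⟧ := biprod.inl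
  let p : cokernel g ⊞ (kernel g)⟦(1 : ℤ)⟧ ⟶ (kernel g)⟦(1 : ℤ)⟧ := biprod.snd
  have hw : (p ≫ (kernel.ι g)⟦(1 : ℤ)⟧') ≫ (cokernel.π f ≫ i)⟦(1 : ℤ)⟧' =
      (p ≫ (kernel.ι g ≫ cokernel.π f)⟦(1 : ℤ)⟧') ≫ i⟦(1 : ℤ)⟧' := by
    simp only [Functor.map_comp, Category.assoc]
  have hw' : (p ≫ (kernel.ι g)⟦(1 : ℤ)⟧') ≫ (cokernel.π f ≫ i)⟦(1 : ℤ)⟧' =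
      p ≫ ((kernel.ι g ≫ cokernel.π f) ≫ i)⟦(1 : ℤ)⟧' := by
    simp only [Functor.map_comp, Category.assoc]
  refine ⟨e₃.biprod_map (e₀.map _), ?_, ?_⟩
  · change SplitExact _ ((p ≫ (kernel.ι g)⟦(1 : ℤ)⟧') ≫ (cokernel.π f ≫ i)⟦(1 : ℤ)⟧')
    rw [hw]
    refine SplitExact.postcomp (ρ := biprod.fst⟦(1 : ℤ)⟧')
      ((e₁.map (shiftFunctor C (1 : ℤ))).biprod_map_snd hσ) ?_
    rw [← Functor.map_comp, biprod.inl_fst, CategoryTheory.Functor.map_id]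
  · change SplitExact ((p ≫ (kernel.ι g)⟦(1 : ℤ)⟧') ≫ (cokernel.π f ≫ i)⟦(1 : ℤ)⟧') 
      ((shiftFunctor C (1 : ℤ)).map _)
    rw [hw']
    refine SplitExact.precomp (σ := biprod.inr)
      ((e₂.inl_biprod_map (ρ := ρ⟦(1 : ℤ)⟧') ?_).map (shiftFunctor C (1 : ℤ))) biprod.inr_snd
    rw [← Functor.map_comp, hρ, CategoryTheory.Functor.map_id]

lemma isTriangulated_splitPretriangulated
    (hsplit : ∀ (X Y : C) (f : X ⟶ Y), Mono f → ∃ r : Y ⟶ X, f ≫ r = 𝟙 X) :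
    letI := splitPretriangulated hsplit
    IsTriangulated C := by
  let := splitPretriangulated hsplit
  refine IsTriangulated.mk' fun X Y Z f g ↦ ⟨X, Y, Z, _, _, _, f, g, .refl _, .refl _, .refl _,
    by simp, by simp, _, _, isSplitExactTriangle_cone hsplit f, _, _,
    isSplitExactTriangle_cone hsplit g, _, _, isSplitExactTriangle_cone hsplit (f ≫ g),
    ⟨⟨_, _, ?_, ?_, ?_, ?_, isSplitExactTriangle_octahedron hsplit f g⟩⟩⟩
  · simp
  · simp [← Functor.map_comp]
  · simp
  · simp [← Functor.map_comp]

lemma isSplitExactTriangle_splitTriangle (A B D : C) :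
    IsSplitExactTriangle (splitTriangle C A B D) := by
  have h₁ : SplitExact (biprod.snd ≫ biprod.inl : A ⊞ B ⟶ B ⊞ D)
      (biprod.snd ≫ biprod.inl : B ⊞ D ⟶ D ⊞ A⟦(1 : ℤ)⟧) :=
    ⟨by simp, biprod.fst ≫ biprod.inr, biprod.fst ≫ biprod.inr, by simp [biprod.total]⟩
  have h₂ : SplitExact (biprod.snd ≫ biprod.inl : B ⊞ D ⟶ D ⊞ A⟦(1 : ℤ)⟧)
      (biprod.snd ≫ (biprod.inl : A ⟶ A ⊞ B)⟦(1 : ℤ)⟧') :=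
    ⟨by simp, biprod.fst ≫ biprod.inr, biprod.fst⟦(1 : ℤ)⟧' ≫ biprod.inr, by
      simp [biprod.total, ← Functor.map_comp_assoc]⟩
  have h₃ : SplitExact (biprod.inl : A ⟶ A ⊞ B) (biprod.snd ≫ biprod.inl : A ⊞ B ⟶ B ⊞ D) :=
    ⟨by simp, biprod.fst, biprod.fst ≫ biprod.inr, by simp [biprod.total]⟩
  exact ⟨h₁, h₂, (h₃.map (shiftFunctor C (1 : ℤ))).precomp biprod.inr_snd⟩

lemma IsSplitExactTriangle.exists_iso_splitTriangle
    (hsplit : ∀ (X Y : C) (f : X ⟶ Y), Mono f → ∃ r : Y ⟶ X, f ≫ r = 𝟙 X)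
    {T : Triangle C} (hT : IsSplitExactTriangle T) :
    ∃ A B D : C, Nonempty (T ≅ splitTriangle C A B D) := by
  have := injective_of_mono_split hsplit
  let f := T.mor₁
  let φ : ShortComplex.mk (kernel.ι f) (Abelian.factorThruImage f)
      (by simp [← cancel_mono (Abelian.image.ι f)]) ⟶
        ShortComplex.mk (kernel.ι f) f (by simp) :=
    { τ₁ := 𝟙 _
      τ₂ := 𝟙 _
      τ₃ := Abelian.image.ι f }
  have : Epi φ.τ₁ := by dsimp [φ]; infer_instance
  have : IsIso φ.τ₂ := by dsimp [φ]; infer_instance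
  have : Mono φ.τ₃ := by dsimp [φ]; infer_instance
  have h₁ : (ShortComplex.mk (kernel.ι f) (Abelian.factorThruImage f)
      (by simp [← cancel_mono (Abelian.image.ι f)])).ShortExact :=
    { exact := (ShortComplex.exact_iff_of_epi_of_isIso_of_mono φ).2 (ShortComplex.exact_kernel f) }
  have h₂ : (ShortComplex.mk (Abelian.image.ι f) (cokernel.π f) (by simp)).ShortExact :=
    { exact := ShortComplex.exact_kernel _ }
  let s₁ := h₁.splittingOfInjective
  let s₂ := h₂.splittingOfInjective
  let := splitPretriangulated hsplit
  refine ⟨_, _, _, ⟨(isoTriangleOfIso₁₂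
    (splitTriangle C (kernel f) (Abelian.image f) (cokernel f)) T
    (isSplitExactTriangle_splitTriangle _ _ _) hT s₁.isoBinaryBiproduct.symm
    s₂.isoBinaryBiproduct.symm ?_).symm⟩⟩
  have hs : s₁.s ≫ f = Abelian.image.ι f := by
    simpa using s₁.s_g =≫ Abelian.image.ι f
  change (biprod.snd ≫ biprod.inl) ≫ biprod.desc (Abelian.image.ι f) s₂.s =
    biprod.desc (kernel.ι f) s₁.s ≫ f
  ext
  · simp
  · simp [hs]

end Triangles

/-- an abelian category in which every monomorphism splits, together with an
additive auto-equivalence `S`, admits a triangulated structure with suspension `S` whose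
distinguished triangles are exactly the diagrams isomorphic to the basic split triangles. -/
theorem abelian_split_admits_triangulation (C : Type u) [Category.{v} C] [Abelian C]
    (hsplit : ∀ (X Y : C) (f : X ⟶ Y), Mono f → ∃ r : Y ⟶ X, f ≫ r = 𝟙 X)
    (S : C ⥤ C) [S.Additive] [S.IsEquivalence] :
    ∃ hs : HasShift C ℤ, by
      letI := hs
      exact Nonempty (shiftFunctor C (1 : ℤ) ≅ S) ∧
        ∃ add : ∀ n : ℤ, (shiftFunctor C n).Additive, by
          letI := add
          exact ∃ pre : Pretriangulated C, by
            letI := pre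
            exact IsTriangulated C ∧
              ∀ T : Triangle C,
                (T ∈ (distTriang C) ↔ ∃ A B D : C, Nonempty (T ≅ splitTriangle C A B D)) := by
  let := shiftOfEquivalence S
  have add (n : ℤ) : (shiftFunctor C n).Additive := shiftFunctor_additive n
  exact ⟨_, ⟨shiftOfEquivalenceIso S⟩, add, splitPretriangulated hsplit,
    isTriangulated_splitPretriangulated hsplit, fun T ↦
      ⟨fun h ↦ IsSplitExactTriangle.exists_iso_splitTriangle hsplit h,
        fun ⟨A, B, D, ⟨e⟩⟩ ↦ (isSplitExactTriangle_splitTriangle A B D).of_iso e.symm⟩⟩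

end AxStable
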